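/- Let S and A be finite nonempty types, let P₁, P₂ : S → A → PMF S be transition kernels satisfying ∑_{s' ∈ S} |(P₁ s a s').toReal − (P₂ s a s').toReal| ≤ α for all s, a, and let R₁, R₂ : S → A → ℝ be reward functions with |R₁ s a − R₂ s a| ≤ α and 0 ≤ R₁ s a ≤ Rmax for all s, a, where α ≥ 0 and Rmax ≥ 0. For any time-dependent policy π : ℕ → S → A, define the h-step value functions recursively by Vᵢ^π(0, s) = 0 and Vᵢ^π(h+1, s) = Rᵢ(s, π h s) + ∑_{s' ∈ S} (Pᵢ s (π h s) s').toReal · Vᵢ^π(h, s') for i = 1, 2. Then: (i) for every policy π, horizon h, and state s, |V₁^π(h, s) − V₂^π(h, s)| ≤ h·α + α·Rmax·h·(h−1)/2; and (ii) for any fixed horizon H and state s₀, if a policy π̂ satisfies V₂^{π̂}(H, s₀) ≥ V₂^π(H, s₀) for every policy π, then V₁^{π̂}(H, s₀) ≥ V₁^π(H, s₀) − 2·(H·α + α·Rmax·H·(H−1)/2) for every policy π. -/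

import Mathlib

/-- The `h`-step value function of a time-dependent policy `π` in a finite
stochastic MDP with transition kernel `P` and reward function `R`. -/
noncomputable def stochVal {S A : Type*} [Fintype S]
    (P : S → A → PMF S) (R : S → A → ℝ) (π : ℕ → S → A) : ℕ → S → ℝ
  | 0, _ => 0
  | h + 1, s =>
      R s (π h s) + ∑ s' : S, (P s (π h s) s').toReal * stochVal P R π h s'

theorem PMF.sum_toReal_eq_one {S : Type*} [Fintype S] (p : PMF S) :
    ∑ s : S, (p s).toReal = 1 := by
  rw [← ENNReal.toReal_sum fun s _ => p.apply_ne_top s, ← tsum_fintype (L := .unconditional S),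
    p.tsum_coe, ENNReal.toReal_one]

theorem PMF.abs_sum_toReal_mul_le {S : Type*} [Fintype S] (p : PMF S) {f : S → ℝ} {C : ℝ}
    (hf : ∀ s, |f s| ≤ C) : |∑ s : S, (p s).toReal * f s| ≤ C := by
  calc |∑ s : S, (p s).toReal * f s|
      ≤ ∑ s : S, |(p s).toReal * f s| := Finset.abs_sum_le_sum_abs _ _
    _ ≤ ∑ s : S, (p s).toReal * C := by
        refine Finset.sum_le_sum fun s _ => ?_
        rw [abs_mul, abs_of_nonneg ENNReal.toReal_nonneg]
        exact mul_le_mul_of_nonneg_left (hf s) ENNReal.toReal_nonneg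
    _ = C := by rw [← Finset.sum_mul, p.sum_toReal_eq_one, one_mul]

theorem abs_stochVal_le {S A : Type*} [Fintype S] (P : S → A → PMF S) {R : S → A → ℝ}
    {C : ℝ} (hR : ∀ s a, |R s a| ≤ C) (π : ℕ → S → A) (h : ℕ) (s : S) :
    |stochVal P R π h s| ≤ h * C := by
  induction h generalizing s with
  | zero => simp [stochVal]
  | succ h ih =>
    rw [stochVal]
    have h₁ := (P s (π h s)).abs_sum_toReal_mul_le ih
    refine (abs_add_le _ _).trans ?_
    push_cast
    linarith [hR s (π h s)]

theorem abs_stochVal_sub_le {S A : Type*} [Fintype S] {P₁ P₂ : S → A → PMF S}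
    {R₁ R₂ : S → A → ℝ} {α C : ℝ} (hC : 0 ≤ C)
    (hP : ∀ s a, ∑ s' : S, |(P₁ s a s').toReal - (P₂ s a s').toReal| ≤ α)
    (hR : ∀ s a, |R₁ s a - R₂ s a| ≤ α) (hR₁ : ∀ s a, |R₁ s a| ≤ C)
    (π : ℕ → S → A) (h : ℕ) (s : S) :
    |stochVal P₁ R₁ π h s - stochVal P₂ R₂ π h s| ≤
      (h : ℝ) * α + α * C * ((h : ℝ) * ((h : ℝ) - 1) / 2) := by
  induction h generalizing s with
  | zero => simp [stochVal]
  | succ h ih =>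
    rw [stochVal, stochVal]
    set a := π h s
    have hsplit : R₁ s a + ∑ s', (P₁ s a s').toReal * stochVal P₁ R₁ π h s' -
        (R₂ s a + ∑ s', (P₂ s a s').toReal * stochVal P₂ R₂ π h s') =
        (R₁ s a - R₂ s a) +
          ∑ s', ((P₁ s a s').toReal - (P₂ s a s').toReal) * stochVal P₁ R₁ π h s' +
          ∑ s', (P₂ s a s').toReal * (stochVal P₁ R₁ π h s' - stochVal P₂ R₂ π h s') := by
      simp only [sub_mul, mul_sub, Finset.sum_sub_distrib]
      ring
    have hkernel : |∑ s', ((P₁ s a s').toReal - (P₂ s a s').toReal) *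
        stochVal P₁ R₁ π h s'| ≤ α * (h * C) := by
      refine (Finset.abs_sum_le_sum_abs _ _).trans ?_
      refine le_trans ?_ (mul_le_mul_of_nonneg_right (hP s a) (by positivity))
      rw [Finset.sum_mul]
      refine Finset.sum_le_sum fun s' _ => ?_
      rw [abs_mul]
      exact mul_le_mul_of_nonneg_left (abs_stochVal_le P₁ hR₁ π h s') (abs_nonneg _)
    have hvalue := (P₂ s a).abs_sum_toReal_mul_le ih
    rw [hsplit]
    refine (abs_add_three _ _ _).trans ?_
    push_cast
    linarith [hR s a]

theorem simulation_lemma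
    {S A : Type*} [Fintype S] [Nonempty S] [Fintype A] [Nonempty A]
    (P₁ P₂ : S → A → PMF S) (R₁ R₂ : S → A → ℝ) (α Rmax : ℝ)
    (hα : 0 ≤ α) (hRmax : 0 ≤ Rmax)
    (hP : ∀ s a, ∑ s' : S, |(P₁ s a s').toReal - (P₂ s a s').toReal| ≤ α)
    (hR : ∀ s a, |R₁ s a - R₂ s a| ≤ α)
    (hR₁ : ∀ s a, 0 ≤ R₁ s a ∧ R₁ s a ≤ Rmax) :
    (∀ (π : ℕ → S → A) (h : ℕ) (s : S),
        |stochVal P₁ R₁ π h s - stochVal P₂ R₂ π h s| ≤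
          (h : ℝ) * α + α * Rmax * ((h : ℝ) * ((h : ℝ) - 1) / 2)) ∧
    (∀ (H : ℕ) (s₀ : S) (πhat : ℕ → S → A),
        (∀ π : ℕ → S → A, stochVal P₂ R₂ πhat H s₀ ≥ stochVal P₂ R₂ π H s₀) →
        ∀ π : ℕ → S → A,
          stochVal P₁ R₁ πhat H s₀ ≥
            stochVal P₁ R₁ π H s₀ -
              2 * ((H : ℝ) * α + α * Rmax * ((H : ℝ) * ((H : ℝ) - 1) / 2))) := by
  have hval := abs_stochVal_sub_le hRmax hP hR fun s a =>
    (abs_of_nonneg (hR₁ s a).1).trans_le (hR₁ s a).2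
  refine ⟨hval, fun H s₀ πhat hopt π => ?_⟩
  have h₁ := abs_le.mp (hval πhat H s₀)
  have h₂ := abs_le.mp (hval π H s₀)
  linarith [hopt π, h₁.1, h₂.2]
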